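/- Let b, c, h be real numbers with 0 ≤ c < b and h > 0. Then ∫_{b}^{b+h} (τ² − b²)^{−1/2} (τ² − c²)^{−1/2} dτ ≤ (1/(2b)) · ln( 1 + (4bh + 2h² + 2 sqrt((b+h)⁴ − b⁴)) / (b² − c²) ). -/

import Mathlib

open MeasureTheory Set

/-- Let `b, c, h` be real numbers with `0 ≤ c < b` and `h > 0`. Then
`∫_{b}^{b+h} (τ² − b²)^{−1/2} (τ² − c²)^{−1/2} dτ
  ≤ (1/(2b)) ln(1 + (4bh + 2h² + 2 √((b+h)⁴ − b⁴)) / (b² − c²))`. -/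
theorem stmt_13 (b c h : ℝ) (hc : 0 ≤ c) (hcb : c < b) (hh : 0 < h) :
    (∫⁻ τ in Ioo b (b + h),
        ENNReal.ofReal ((Real.sqrt (τ ^ 2 - b ^ 2))⁻¹ * (Real.sqrt (τ ^ 2 - c ^ 2))⁻¹)) ≤
      ENNReal.ofReal (1 / (2 * b) *
        Real.log (1 + (4 * b * h + 2 * h ^ 2 +
          2 * Real.sqrt ((b + h) ^ 4 - b ^ 4)) / (b ^ 2 - c ^ 2))) := by
  have hb : 0 < b := lt_of_le_of_lt hc hcb
  have hd : 0 < b ^ 2 - c ^ 2 := by nlinarith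
  let F : ℝ → ℝ := fun τ => 1 / b * Real.log (√(τ ^ 2 - b ^ 2) + √(τ ^ 2 - c ^ 2))
  let f : ℝ → ℝ := fun τ => τ / b * ((√(τ ^ 2 - b ^ 2))⁻¹ * (√(τ ^ 2 - c ^ 2))⁻¹)
  have hpos : ∀ τ, b ≤ τ → 0 < √(τ ^ 2 - b ^ 2) + √(τ ^ 2 - c ^ 2) := by
    intro τ hτ
    have : 0 < √(τ ^ 2 - c ^ 2) := Real.sqrt_pos.2 (by nlinarith)
    positivity
  have hcont : ContinuousOn F (Icc b (b + h)) := by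
    refine ContinuousOn.mul continuousOn_const (ContinuousOn.log ?_ ?_)
    · exact Continuous.continuousOn (by fun_prop)
    · intro x hx
      exact (hpos x hx.1).ne'
  have hder : ∀ x ∈ Ioo b (b + h), HasDerivAt F (f x) x := by
    intro x hx
    have h1 : 0 < x ^ 2 - b ^ 2 := by nlinarith [hx.1]
    have h2 : 0 < x ^ 2 - c ^ 2 := by linarith
    have d1 : HasDerivAt (fun τ : ℝ => τ ^ 2 - b ^ 2) (2 * x) x := by
      simpa using (hasDerivAt_pow 2 x).sub_const (b ^ 2)
    have d2 : HasDerivAt (fun τ : ℝ => τ ^ 2 - c ^ 2) (2 * x) x := by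
      simpa using (hasDerivAt_pow 2 x).sub_const (c ^ 2)
    have := (((d1.sqrt h1.ne').add (d2.sqrt h2.ne')).log (hpos x hx.1.le).ne').const_mul (1 / b)
    refine this.congr_deriv ?_
    have s1 := Real.sqrt_pos.2 h1
    have s2 := Real.sqrt_pos.2 h2
    simp only [f, Pi.add_apply]
    field_simp
    ring
  have hnn : ∀ x ∈ Ioo b (b + h), 0 ≤ f x := by
    intro x hx
    have : 0 < x := hb.trans hx.1
    simp only [f]; positivity
  have hle : b ≤ b + h := by linarith
  have hint : IntegrableOn f (Ioc b (b + h)) :=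
    intervalIntegral.integrableOn_deriv_of_nonneg hcont hder hnn
  have hI : ∫ x in b..(b + h), f x = F (b + h) - F b :=
    intervalIntegral.integral_eq_sub_of_hasDerivAt_of_le hle hcont hder
      ((intervalIntegrable_iff_integrableOn_Ioc_of_le hle).2 hint)
  rw [intervalIntegral.integral_of_le hle, integral_Ioc_eq_integral_Ioo] at hI
  have hint' : IntegrableOn f (Ioo b (b + h)) := hint.mono_set Ioo_subset_Ioc_self
  calc _ ≤ ∫⁻ τ in Ioo b (b + h), ENNReal.ofReal (f τ) := by
        refine setLIntegral_mono' measurableSet_Ioo ?_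
        intro x hx
        refine ENNReal.ofReal_le_ofReal ?_
        have : 1 ≤ x / b := (one_le_div hb).2 hx.1.le
        exact le_mul_of_one_le_left (by positivity) this
    _ = ENNReal.ofReal (F (b + h) - F b) := by
        rw [← hI, ofReal_integral_eq_lintegral_ofReal hint'
          ((ae_restrict_iff' measurableSet_Ioo).2 (Filter.Eventually.of_forall hnn))]
    _ ≤ _ := by
        refine ENNReal.ofReal_le_ofReal ?_
        set u := (b + h) ^ 2 - b ^ 2 with hu
        have hu0 : 0 < u := by rw [hu]; nlinarith
        have hv0 : 0 < (b + h) ^ 2 - c ^ 2 := by linarith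
        have hP := hpos (b + h) hle
        have hQ : 0 < √(b ^ 2 - c ^ 2) := Real.sqrt_pos.2 hd
        have e : F (b + h) - F b = 1 / (2 * b) *
            Real.log (((√u + √((b + h) ^ 2 - c ^ 2)) / √(b ^ 2 - c ^ 2)) ^ 2) := by
          rw [Real.log_pow, Real.log_div hP.ne' hQ.ne']
          simp only [F, sub_self, Real.sqrt_zero, zero_add, ← hu]
          push_cast
          field_simp
        rw [e]
        refine mul_le_mul_of_nonneg_left (Real.log_le_log (by positivity) ?_) (by positivity)
        rw [div_pow, Real.sq_sqrt hd.le, add_sq, Real.sq_sqrt hu0.le, Real.sq_sqrt hv0.le,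
          mul_assoc, ← Real.sqrt_mul hu0.le]
        have hs : √(u * ((b + h) ^ 2 - c ^ 2)) ≤ √((b + h) ^ 4 - b ^ 4) := by
          apply Real.sqrt_le_sqrt
          have : (b + h) ^ 4 - b ^ 4 = u * ((b + h) ^ 2 + b ^ 2) := by rw [hu]; ring
          rw [this]
          exact mul_le_mul_of_nonneg_left (by nlinarith) hu0.le
        rw [div_le_iff₀ hd, add_mul, div_mul_cancel₀ _ hd.ne']
        nlinarith
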